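/- arXiv:0907.0845 — 4 statements merged into one kernel-verified Lean document; each statement's English description precedes it below -/
import Mathlib

section
/- Let G = (V,E) be an oriented graph, k a positive integer, and let φ⁻_G(k) denote the number of pairs (f,σ) where f is a Z_k-flow on G and σ ⊆ E \ supp(f) is a totally cyclic reorientation of G_/supp(f). Then: (1) if E = ∅ then φ⁻_G(k) = 1; (2) if some e ∈ E is a coloop then φ⁻_G(k) = 0; (3) if e ∈ E is a loop then φ⁻_G(k) = (k+1) · φ⁻_{G_∖e}(k); (4) if e ∈ E is neither a loop nor a coloop then φ⁻_G(k) = φ⁻_{G_∖e}(k) + φ⁻_{G_/e}(k). -/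
namespace ModularFlows

attribute [local instance] Classical.propDecidable

variable {V E : Type}

/-- A directed (simple) cycle, given by its cyclically ordered edges
`c 0, c 1, …, c n`: consecutive edges are head-to-tail compatible (also from
`c n` back to `c 0`) and the start vertices are pairwise distinct. -/
def IsDirCycle (src tgt : E → V) (n : ℕ) (c : Fin (n + 1) → E) : Prop :=
  Function.Injective (fun i => src (c i)) ∧ ∀ i, tgt (c i) = src (c (i + 1))

/-- An oriented graph is totally cyclic if every edge lies on a directed cycle. -/
def TotallyCyclic (src tgt : E → V) : Prop :=
  ∀ e : E, ∃ (n : ℕ) (c : Fin (n + 1) → E), IsDirCycle src tgt n c ∧ e ∈ Set.range c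

/-- An oriented graph is acyclic if it contains no directed cycle. -/
def Acyclic (src tgt : E → V) : Prop :=
  ∀ (n : ℕ) (c : Fin (n + 1) → E), ¬ IsDirCycle src tgt n c

/-- Source map of the reorientation of the graph along `σ`. -/
noncomputable def rsrc (src tgt : E → V) (σ : Set E) (e : E) : V :=
  if e ∈ σ then tgt e else src e

/-- Target map of the reorientation of the graph along `σ`. -/
noncomputable def rtgt (src tgt : E → V) (σ : Set E) (e : E) : V :=
  if e ∈ σ then src e else tgt e

/-- A `ZMod k`-flow: conservation of flow at every vertex. -/
def IsFlow [Fintype E] (src tgt : E → V) (k : ℕ) (f : E → ZMod k) : Prop :=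
  ∀ v : V, (∑ e : E, if tgt e = v then f e else 0) = ∑ e : E, if src e = v then f e else 0

/-- Start vertex of an edge traversed forwards (`true`) or backwards (`false`). -/
def uSrc (src tgt : E → V) (p : E × Bool) : V := if p.2 then src p.1 else tgt p.1

/-- End vertex of an edge traversed forwards (`true`) or backwards (`false`). -/
def uTgt (src tgt : E → V) (p : E × Bool) : V := if p.2 then tgt p.1 else src p.1

/-- A cycle of the underlying undirected graph, with a chosen traversal
direction: a cyclic sequence of edges, each traversed forwards or backwards,
consecutive ones compatible, visiting pairwise distinct vertices. -/
def IsUCycle (src tgt : E → V) (n : ℕ) (c : Fin (n + 1) → E × Bool) : Prop :=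
  Function.Injective (fun i => uSrc src tgt (c i)) ∧
    ∀ i, uTgt src tgt (c i) = uSrc src tgt (c (i + 1))

/-- A `ZMod l`-tension: the signed sum over every cycle of the underlying
undirected graph (forward edges positively, backward edges negatively) vanishes. -/
def IsTension (src tgt : E → V) (l : ℕ) (t : E → ZMod l) : Prop :=
  ∀ (n : ℕ) (c : Fin (n + 1) → E × Bool), IsUCycle src tgt n c →
    (∑ i : Fin (n + 1), if (c i).2 then t (c i).1 else - t (c i).1) = 0

/-- Adjacency via an edge of `S` (its equivalence closure gives the components
of the spanning subgraph `(V, S)`). -/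
def linkRel (src tgt : E → V) (S : Set E) (u v : V) : Prop :=
  ∃ e ∈ S, src e = u ∧ tgt e = v

/-- Number of (weakly) connected components of the spanning subgraph `(V, S)`. -/
noncomputable def ncompSub (src tgt : E → V) (S : Set E) : ℕ :=
  Nat.card (Quot (linkRel src tgt S))

/-- Number of (weakly) connected components. -/
noncomputable def ncomp (src tgt : E → V) : ℕ :=
  ncompSub src tgt Set.univ

/-- The cyclotomic number `ξ(G) = |E| - |V| + c(G)`. -/
noncomputable def xi [Fintype V] [Fintype E] (src tgt : E → V) : ℤ :=
  (Fintype.card E : ℤ) - (Fintype.card V : ℤ) + (ncomp src tgt : ℤ)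

/-- Source map of the contraction `G/S`: vertices are identified along edges of
`S`, and the edges of `S` are removed. -/
def csrc (src tgt : E → V) (S : Set E) (e : {e : E // e ∉ S}) :
    Quot (linkRel src tgt S) :=
  Quot.mk _ (src e.1)

/-- Target map of the contraction `G/S`. -/
def ctgt (src tgt : E → V) (S : Set E) (e : {e : E // e ∉ S}) :
    Quot (linkRel src tgt S) :=
  Quot.mk _ (tgt e.1)

/-- Source (or target) map of the deletion `G∖S`. -/
def dsrc (src : E → V) (S : Set E) (e : {e : E // e ∉ S}) : V := src e.1

/-- Source (or target) map of the restriction `G[S]`. -/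
def ressrc (src : E → V) (S : Set E) (e : {e : E // e ∈ S}) : V := src e.1

/-- `σ` is a totally cyclic reorientation of the contraction `G/S`. -/
def TCReorContr (src tgt : E → V) (S σ : Set E) : Prop :=
  TotallyCyclic (rsrc (csrc src tgt S) (ctgt src tgt S) {e | e.1 ∈ σ})
                (rtgt (csrc src tgt S) (ctgt src tgt S) {e | e.1 ∈ σ})

/-- `σ` is a totally cyclic reorientation of the deletion `G∖S`. -/
def TCReorDel (src tgt : E → V) (S σ : Set E) : Prop :=
  TotallyCyclic (rsrc (dsrc src S) (dsrc tgt S) {e | e.1 ∈ σ})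
                (rtgt (dsrc src S) (dsrc tgt S) {e | e.1 ∈ σ})

/-- `σ` is an acyclic reorientation of the deletion `G∖S`. -/
def AcyclicReorDel (src tgt : E → V) (S σ : Set E) : Prop :=
  Acyclic (rsrc (dsrc src S) (dsrc tgt S) {e | e.1 ∈ σ})
          (rtgt (dsrc src S) (dsrc tgt S) {e | e.1 ∈ σ})

/-- Entry of the incidence matrix `A_G` at vertex `v` and edge `e`. -/
noncomputable def inc (src tgt : E → V) (v : V) (e : E) : ℤ :=
  (if tgt e = v then 1 else 0) - (if src e = v then 1 else 0)

/-- The number of nowhere-zero `ZMod k`-flows. -/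
noncomputable def nzFlowCount [Fintype E] (src tgt : E → V) (k : ℕ) : ℕ :=
  Nat.card {f : E → ZMod k // IsFlow src tgt k f ∧ ∀ e, f e ≠ 0}

/-- The number of nowhere-zero `ZMod l`-tensions. -/
noncomputable def nzTensionCount (src tgt : E → V) (l : ℕ) : ℕ :=
  Nat.card {t : E → ZMod l // IsTension src tgt l t ∧ ∀ e, t e ≠ 0}

/-- The rank `r(S) = |V| - c(V,S)` of an edge set `S`. -/
noncomputable def rk [Fintype V] (src tgt : E → V) (S : Set E) : ℕ :=
  Fintype.card V - ncompSub src tgt S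

/-- The Tutte polynomial `t_G(x,y) = Σ_{S ⊆ E} (x-1)^{r(E)-r(S)} (y-1)^{|S|-r(S)}`. -/
noncomputable def tutte [Fintype V] [Fintype E] (src tgt : E → V) (x y : ℚ) : ℚ :=
  ∑ S : Finset E,
    (x - 1) ^ (rk src tgt Set.univ - rk src tgt ↑S) * (y - 1) ^ (S.card - rk src tgt ↑S)

/-- `e` is a coloop (bridge): deleting it increases the number of components. -/
def IsColoop (src tgt : E → V) (e : E) : Prop :=
  ncompSub src tgt ({e} : Set E)ᶜ = ncomp src tgt + 1

/-- The number of pairs `(f, σ)` of a `ZMod k`-flow `f` and a totally cyclic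
reorientation `σ ⊆ E ∖ supp f` of the contraction `G/supp f`. -/
noncomputable def phiR [Fintype E] (src tgt : E → V) (k : ℕ) : ℕ :=
  Nat.card {p : (E → ZMod k) × Set E //
    IsFlow src tgt k p.1 ∧ p.2 ⊆ {e | p.1 e = 0} ∧
    TCReorContr src tgt {e | p.1 e ≠ 0} p.2}

/-- The in-degree sequence of the reorientation of the graph along `σ`. -/
noncomputable def indegSeq [Fintype E] (src tgt : E → V) (σ : Set E) (v : V) : ℤ :=
  (Nat.card {e : E // rtgt src tgt σ e = v} : ℤ)

/-- The vector `A_G · e_σ`, where `e_σ` is the characteristic vector of `σ`. -/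
noncomputable def AeVec [Fintype E] (src tgt : E → V) (σ : Set E) (v : V) : ℤ :=
  ∑ e : E, if e ∈ σ then inc src tgt v e else 0

/-- `τ'` is obtained from `τ` by reversing a directed cycle of `_τG`. -/
def cycleReverse (src tgt : E → V) (τ τ' : Set E) : Prop :=
  ∃ (n : ℕ) (c : Fin (n + 1) → E),
    IsDirCycle (rsrc src tgt τ) (rtgt src tgt τ) n c ∧ τ' = symmDiff τ (Set.range c)

section Relation

open Relation

/-- Every step of the relation `r` can be undone by a sequence of steps. -/
def IsReversible {V : Type} (r : V → V → Prop) : Prop :=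
  ∀ u v, r u v → ReflTransGen r v u

theorem IsReversible.reflTransGen_symm {V : Type} {r : V → V → Prop} (h : IsReversible r)
    {u v : V} (huv : ReflTransGen r u v) : ReflTransGen r v u := by
  induction huv with
  | refl => exact .refl
  | tail _ hbc ih => exact (h _ _ hbc).trans ih

theorem IsReversible.of_eqvGen {V : Type} {r : V → V → Prop} (h : IsReversible r)
    {u v : V} (huv : EqvGen r u v) : ReflTransGen r u v := by
  induction huv with
  | rel _ _ h => exact .single h
  | refl => exact .refl
  | symm _ _ _ ih => exact h.reflTransGen_symm ih
  | trans _ _ _ _ _ ih₁ ih₂ => exact ih₁.trans ih₂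

theorem eqvGen_of_reflTransGen {V : Type} {r : V → V → Prop} {u v : V}
    (h : ReflTransGen r u v) : EqvGen r u v := by
  induction h with
  | refl => exact .refl _
  | tail _ hbc ih => exact .trans _ _ _ ih (.rel _ _ hbc)

/-- The relation `r` with the additional step from `x` to `y`. -/
def addStep {V : Type} (r : V → V → Prop) (x y : V) (u v : V) : Prop :=
  r u v ∨ (u = x ∧ v = y)

theorem reflTransGen_addStep_of_reflTransGen {V : Type} {r : V → V → Prop} (x y : V) {u v : V}
    (h : ReflTransGen r u v) : ReflTransGen (addStep r x y) u v :=
  ReflTransGen.mono (fun _ _ => Or.inl) _ _ h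

theorem reflTransGen_addStep {V : Type} {r : V → V → Prop} {x y u v : V}
    (h : ReflTransGen (addStep r x y) u v) :
    ReflTransGen r u v ∨ (ReflTransGen r u x ∧ ReflTransGen r y v) := by
  induction h with
  | refl => exact .inl .refl
  | tail _ hbc ih =>
    rcases hbc with hbc | ⟨rfl, rfl⟩
    · exact ih.imp (fun h => h.tail hbc) (fun h => ⟨h.1, h.2.tail hbc⟩)
    · exact .inr ⟨ih.elim id And.left, .refl⟩

theorem IsReversible.addStep_of_reflTransGen {V : Type} {r : V → V → Prop} (h : IsReversible r)
    {x y : V} (hyx : ReflTransGen r y x) : 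
    IsReversible (addStep r x y) := by
  rintro u v (huv | ⟨rfl, rfl⟩)
  · exact reflTransGen_addStep_of_reflTransGen _ _ (h _ _ huv)
  · exact reflTransGen_addStep_of_reflTransGen _ _ hyx

theorem IsReversible.addStep_addStep {V : Type} {r : V → V → Prop} {x y : V}
    (h : IsReversible (addStep r x y)) :
    IsReversible (addStep (addStep r x y) y x) :=
  h.addStep_of_reflTransGen (.single (.inr ⟨rfl, rfl⟩))

theorem addStep_comm {V : Type} (r : V → V → Prop) (x y x' y' : V) :
    addStep (addStep r x y) x' y' = addStep (addStep r x' y') x y := by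
  funext u v
  simp only [addStep, or_assoc, or_comm (a := u = x ∧ v = y)]

theorem isReversible_of_addStep {V : Type} {r : V → V → Prop} {x y : V}
    (h₁ : IsReversible (addStep r x y)) (h₂ : IsReversible (addStep r y x)) :
    IsReversible r := by
  intro u v huv
  rcases reflTransGen_addStep (h₁ u v (.inl huv)) with h | ⟨h, -⟩
  · exact h
  rcases reflTransGen_addStep (h₂ u v (.inl huv)) with h' | ⟨-, h'⟩
  · exact h'
  exact h.trans h'

theorem isReversible_addStep_self {V : Type} {r : V → V → Prop} {x : V} :
    IsReversible (addStep r x x) ↔ IsReversible r :=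
  ⟨fun h => isReversible_of_addStep h h, fun h => h.addStep_of_reflTransGen .refl⟩

theorem IsReversible.of_addStep_addStep {V : Type} {r : V → V → Prop} {x y : V}
    (h : IsReversible (addStep (addStep r x y) y x))
    (hyx : ReflTransGen r y x) : IsReversible (addStep r x y) := by
  intro u v huv
  rcases reflTransGen_addStep (h _ _ (.inl huv)) with h | ⟨h₁, h₂⟩
  · exact h
  · exact (h₁.trans (reflTransGen_addStep_of_reflTransGen _ _ hyx)).trans h₂

theorem isReversible_addStep_or {V : Type} {r : V → V → Prop} {x y : V}
    (hxy : EqvGen r x y) (h : IsReversible (addStep (addStep r x y) y x)) :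
    IsReversible (addStep r x y) ∨ IsReversible (addStep r y x) := by
  by_cases hyx : ReflTransGen r y x
  · exact .inl (h.of_addStep_addStep hyx)
  by_cases hxy' : ReflTransGen r x y
  · exact .inr ((addStep_comm r x y y x ▸ h).of_addStep_addStep hxy')
  have hr : IsReversible r := by
    intro u v huv
    rcases reflTransGen_addStep (h u v (.inl (.inl huv))) with h₁ | ⟨h₁, h₂⟩
    · rcases reflTransGen_addStep h₁ with h₁ | ⟨h₁, h₂⟩
      · exact h₁
      · exact absurd ((h₂.tail huv).trans h₁) hyx
    · rcases reflTransGen_addStep h₁ with h₁ | ⟨h₁, -⟩ <;>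
        rcases reflTransGen_addStep h₂ with h₂ | ⟨-, h₂⟩
      · exact absurd ((h₂.tail huv).trans h₁) hxy'
      · exact h₁.trans h₂
      · exact h₁.trans h₂
      · exact absurd ((h₂.tail huv).trans h₁) hyx
  exact absurd (hr.of_eqvGen hxy) hxy'

/-- Deletion–contraction for a step between connected vertices: the two ways of orienting it
are counted by the relation without it and the relation containing it both ways. -/
theorem isReversible_addStep_count {V : Type} {r : V → V → Prop} {x y : V} (hxy : EqvGen r x y) :
    (if IsReversible (addStep r y x) then 1 else 0) + (if IsReversible (addStep r x y) then 1 else 0)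
      = (if IsReversible r then 1 else 0) +
        (if IsReversible (addStep (addStep r x y) y x) then 1 else 0) := by
  by_cases h : IsReversible r
  · have h₁ := h.addStep_of_reflTransGen (h.of_eqvGen (hxy.symm))
    have h₂ := h.addStep_of_reflTransGen (h.of_eqvGen hxy)
    simp [h, h₁, h₂, IsReversible.addStep_addStep h₁]
  · by_cases h₁ : IsReversible (addStep r x y)
    · have h₂ : ¬ IsReversible (addStep r y x) := fun h₂ => h (isReversible_of_addStep h₁ h₂)
      simp [h, h₁, h₂, IsReversible.addStep_addStep h₁]
    · by_cases h₂ : IsReversible (addStep r y x)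
      · have h₃ := IsReversible.addStep_addStep h₂
        rw [addStep_comm] at h₃
        simp [h, h₁, h₂, h₃]
      · have h₃ : ¬ IsReversible (addStep (addStep r x y) y x) := fun h₃ =>
          (isReversible_addStep_or hxy h₃).elim h₁ h₂
        simp [h, h₁, h₂, h₃]

theorem reflTransGen_map_quot {V : Type} {r s t : V → V → Prop}
    (ht : ∀ u v, t u v ↔ r u v ∨ s u v ∨ s v u) {u v : V} :
    ReflTransGen (Relation.Map r (Quot.mk s) (Quot.mk s)) (Quot.mk s u) (Quot.mk s v) ↔
      ReflTransGen t u v := by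
  have key : ∀ u v, EqvGen s u v → ReflTransGen t u v := by
    have hrev : IsReversible (fun u v => s u v ∨ s v u) := fun u v h => .single h.symm
    intro u v h
    exact ReflTransGen.mono (fun _ _ h => (ht _ _).2 (.inr h)) _ _
      (hrev.of_eqvGen (EqvGen.mono (fun _ _ => Or.inl) _ _ h))
  constructor
  · intro h
    generalize hb : Quot.mk s v = b at h
    induction h generalizing v with
    | refl => exact key _ _ (Quot.eqvGen_exact hb.symm)
    | tail _ hbc ih =>
      obtain ⟨c, d, hcd, hc, hd⟩ := hbc
      exact ((ih hc).tail ((ht _ _).2 (.inl hcd))).trans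
        (key _ _ (Quot.eqvGen_exact (hd.trans hb.symm)))
  · intro h
    induction h with
    | refl => exact .refl
    | tail _ hbc ih =>
      rcases (ht _ _).1 hbc with h | h | h
      · exact ih.tail ⟨_, _, h, rfl, rfl⟩
      · rwa [← Quot.sound h]
      · rwa [Quot.sound h]

theorem isReversible_map_quot {V : Type} {r s t : V → V → Prop}
    (ht : ∀ u v, t u v ↔ r u v ∨ s u v ∨ s v u) :
    IsReversible (Relation.Map r (Quot.mk s) (Quot.mk s)) ↔ IsReversible t := by
  constructor
  · intro h u v huv
    rcases (ht _ _).1 huv with h' | h' | h'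
    · exact (reflTransGen_map_quot ht).1 (h _ _ ⟨u, v, h', rfl, rfl⟩)
    · exact .single ((ht _ _).2 (.inr (.inr h')))
    · exact .single ((ht _ _).2 (.inr (.inl h')))
  · rintro h _ _ ⟨u, v, huv, rfl, rfl⟩
    exact (reflTransGen_map_quot ht).2 (h _ _ ((ht _ _).2 (.inl huv)))

end Relation

section TotallyCyclic

open Relation

/-- The list `l` of edges is a directed walk from `u` to `w`. -/
def IsWalk (src tgt : E → V) (w : V) : V → List E → Prop
  | u, [] => u = w
  | u, a :: l => src a = u ∧ IsWalk src tgt w (tgt a) l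

/-- There is an edge from `u` to `v`. -/
def edgeStep (src tgt : E → V) (u v : V) : Prop := ∃ a, src a = u ∧ tgt a = v

theorem IsWalk.of_append {src tgt : E → V} {w : V} {a : E} {l₁ l₂ : List E} :
    ∀ {u : V}, IsWalk src tgt w u (l₁ ++ a :: l₂) → IsWalk src tgt w (src a) (a :: l₂) := by
  induction l₁ with
  | nil => exact fun h => ⟨rfl, h.2⟩
  | cons b l₁ ih => exact fun h => ih h.2

theorem exists_simple_walk {src tgt : E → V} {u w : V}
    (h : ReflTransGen (edgeStep src tgt) u w) :
    ∃ l : List E, IsWalk src tgt w u l ∧ (w :: l.map src).Nodup := by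
  induction h using ReflTransGen.head_induction_on with
  | refl => exact ⟨[], rfl, by simp⟩
  | @head u v huv _ ih =>
    obtain ⟨l, hl, hnd⟩ := ih
    obtain ⟨a, rfl, rfl⟩ := huv
    by_cases hw : src a = w
    · exact ⟨[], hw, by simp⟩
    by_cases ha : src a ∈ l.map src
    · obtain ⟨b, hb, hba⟩ := List.mem_map.1 ha
      obtain ⟨l₁, l₂, rfl⟩ := List.append_of_mem hb
      refine ⟨b :: l₂, hba ▸ hl.of_append, hnd.sublist ?_⟩
      rw [List.map_append]
      exact (List.sublist_append_right _ _).cons_cons _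
    · refine ⟨a :: l, ⟨rfl, hl⟩, ?_⟩
      rw [List.nodup_cons] at hnd
      simp only [List.map_cons, List.nodup_cons, List.mem_cons, not_or]
      exact ⟨⟨Ne.symm hw, hnd.1⟩, ha, hnd.2⟩

theorem IsWalk.tgt_getElem {src tgt : E → V} {w : V} {l : List E} :
    ∀ {u : V}, IsWalk src tgt w u l → ∀ (i : ℕ) (hi : i < l.length),
      tgt l[i] = if h : i + 1 < l.length then src l[i + 1] else w := by
  induction l with
  | nil => intro u _ i hi; simp at hi
  | cons a l ih =>
    intro u h i hi
    cases i with
    | zero =>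
      cases l with
      | nil => simpa [IsWalk] using h.2
      | cons b l => simpa using h.2.1.symm
    | succ i => simpa using ih h.2 i (by simpa using hi)

theorem reflTransGen_of_isDirCycle {src tgt : E → V} {n : ℕ} {c : Fin (n + 1) → E}
    (h : IsDirCycle src tgt n c) (i j : Fin (n + 1)) :
    ReflTransGen (edgeStep src tgt) (tgt (c i)) (src (c j)) := by
  have key : ∀ d : Fin (n + 1), ReflTransGen (edgeStep src tgt) (tgt (c i))
      (src (c (i + 1 + d))) := by
    intro d
    induction d using Fin.induction with
    | zero => rw [add_zero, ← h.2 i]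
    | succ d ih =>
      refine ih.tail ⟨_, rfl, ?_⟩
      rw [h.2, add_assoc (i + 1), Fin.coeSucc_eq_succ]
  simpa using key (j - (i + 1))

theorem totallyCyclic_iff_isReversible {src tgt : E → V} :
    TotallyCyclic src tgt ↔ IsReversible (edgeStep src tgt) := by
  constructor
  · rintro h _ _ ⟨a, rfl, rfl⟩
    obtain ⟨n, c, hc, i, rfl⟩ := h a
    exact reflTransGen_of_isDirCycle hc i i
  · intro h a
    obtain ⟨l, hl, hnd⟩ := exists_simple_walk (h _ _ ⟨a, rfl, rfl⟩)
    refine ⟨l.length, fun i => (a :: l)[i.val]'i.isLt, ⟨?_, ?_⟩, 0, rfl⟩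
    · intro i j hij
      have hnd' : ((a :: l).map src).Nodup := hnd
      have := (hnd'.getElem_inj_iff (i := i.val) (j := j.val)
        (hi := by simpa using i.isLt)
        (hj := by simpa using j.isLt)).1
        (by simp only [List.getElem_map]; exact hij)
      exact Fin.ext this
    · intro i
      have hw : IsWalk src tgt (src a) (src a) (a :: l) := ⟨rfl, hl⟩
      rw [hw.tgt_getElem i.val i.isLt]
      rcases Fin.eq_castSucc_or_eq_last i with ⟨j, rfl⟩ | rfl
      · simp
      · simp

/-- Steps of the reorientation along `σ` in which the edges of `S` can be used both ways. -/
def mixedStep (src tgt : E → V) (S σ : Set E) (u v : V) : Prop :=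
  ∃ a, (src a = u ∧ tgt a = v ∧ (a ∈ S ∨ a ∉ σ)) ∨ (tgt a = u ∧ src a = v ∧ (a ∈ S ∨ a ∈ σ))

theorem tcReorContr_iff {src tgt : E → V} {S σ : Set E} :
    TCReorContr src tgt S σ ↔ IsReversible (mixedStep src tgt S σ) := by
  rw [TCReorContr, totallyCyclic_iff_isReversible]
  let r : V → V → Prop := fun u v => ∃ a, a ∉ S ∧
    ((src a = u ∧ tgt a = v ∧ a ∉ σ) ∨ (tgt a = u ∧ src a = v ∧ a ∈ σ))
  have hr : edgeStep (rsrc (csrc src tgt S) (ctgt src tgt S) {e | e.1 ∈ σ})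
      (rtgt (csrc src tgt S) (ctgt src tgt S) {e | e.1 ∈ σ}) =
      Relation.Map r (Quot.mk (linkRel src tgt S)) (Quot.mk (linkRel src tgt S)) := by
    funext p q
    apply propext
    constructor
    · rintro ⟨⟨a, ha⟩, rfl, rfl⟩
      by_cases hσ : a ∈ σ
      · exact ⟨tgt a, src a, ⟨a, ha, .inr ⟨rfl, rfl, hσ⟩⟩, by simp [rsrc, ctgt, hσ],
          by simp [rtgt, csrc, hσ]⟩
      · exact ⟨src a, tgt a, ⟨a, ha, .inl ⟨rfl, rfl, hσ⟩⟩, by simp [rsrc, csrc, hσ],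
          by simp [rtgt, ctgt, hσ]⟩
    · rintro ⟨_, _, ⟨a, ha, ⟨rfl, rfl, hσ⟩ | ⟨rfl, rfl, hσ⟩⟩, rfl, rfl⟩ <;>
        exact ⟨⟨a, ha⟩, by simp [rsrc, csrc, ctgt, hσ], by simp [rtgt, csrc, ctgt, hσ]⟩
  rw [hr]
  apply isReversible_map_quot
  intro u v
  constructor
  · rintro ⟨a, h⟩
    by_cases ha : a ∈ S
    · rcases h with ⟨h₁, h₂, -⟩ | ⟨h₁, h₂, -⟩
      · exact .inr (.inl ⟨a, ha, h₁, h₂⟩)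
      · exact .inr (.inr ⟨a, ha, h₂, h₁⟩)
    · simp only [ha, false_or] at h
      exact .inl ⟨a, ha, h⟩
  · rintro (⟨a, -, h⟩ | ⟨a, ha, h₁, h₂⟩ | ⟨a, ha, h₁, h₂⟩)
    · exact ⟨a, by tauto⟩
    · exact ⟨a, by tauto⟩
    · exact ⟨a, by tauto⟩

end TotallyCyclic

section Extend

/-- The function on edges with value `t` at `e` and values `f` on the other edges. -/
noncomputable def extend {α : Type} (e : E) (t : α) (f : {a : E // a ∉ ({e} : Set E)} → α)
    (a : E) : α :=
  if h : a ∈ ({e} : Set E) then t else f ⟨a, h⟩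

@[simp]
theorem extend_self {α : Type} (e : E) (t : α) (f : {a : E // a ∉ ({e} : Set E)} → α) :
    extend e t f e = t := by
  simp [extend]

@[simp]
theorem extend_coe {α : Type} (e : E) (t : α) (f : {a : E // a ∉ ({e} : Set E)} → α)
    (a : {a : E // a ∉ ({e} : Set E)}) : extend e t f a = f a := by
  simp [extend, a.2]

/-- A function on edges amounts to its value at `e` and its restriction to the other edges. -/
noncomputable def extendEquiv (α : Type) (e : E) :
    ({a : E // a ∉ ({e} : Set E)} → α) × α ≃ (E → α) where
  toFun p := extend e p.2 p.1
  invFun f := (fun a => f a, f e)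
  left_inv p := by ext <;> simp
  right_inv f := by
    funext a
    by_cases h : a ∈ ({e} : Set E)
    · obtain rfl := h
      simp
    · exact extend_coe e _ _ ⟨a, h⟩

theorem forall_edge_iff (e : E) {p : E → Prop} :
    (∀ a, p a) ↔ p e ∧ ∀ a : {a : E // a ∉ ({e} : Set E)}, p a := by
  refine ⟨fun h => ⟨h e, fun a => h a⟩, fun h a => ?_⟩
  by_cases ha : a ∈ ({e} : Set E)
  · obtain rfl := ha
    exact h.1
  · exact h.2 ⟨a, ha⟩

theorem exists_edge_iff (e : E) {p : E → Prop} :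
    (∃ a, p a) ↔ p e ∨ ∃ a : {a : E // a ∉ ({e} : Set E)}, p a := by
  rw [← not_iff_not, not_exists, not_or, not_exists]
  exact forall_edge_iff e

theorem sum_edge [Fintype E] {M : Type} [AddCommMonoid M] (e : E)
    [Fintype {a : E // a ∉ ({e} : Set E)}] (g : E → M) :
    ∑ a, g a = g e + ∑ a : {a : E // a ∉ ({e} : Set E)}, g a := by
  rw [← Fintype.sum_subtype_add_sum_subtype (fun a => a ∈ ({e} : Set E)) g]
  congr 1
  · refine Finset.sum_eq_single (⟨e, rfl⟩ : {a // a ∈ ({e} : Set E)}) ?_ (by simp)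
    exact fun b _ h => absurd (Subtype.ext (show b.1 = e from b.2)) h
  · congr!

end Extend

section Flow

/-- `(f, σ)` is one of the pairs counted by `phiR`, the edge set `σ` being given by its
membership predicate. -/
def IsPhiPair [Fintype E] (src tgt : E → V) (k : ℕ) (f : E → ZMod k) (σ : E → Prop) : Prop :=
  IsFlow src tgt k f ∧ (∀ a, σ a → f a = 0) ∧
    IsReversible (mixedStep src tgt {a | f a ≠ 0} {a | σ a})

theorem phiR_eq_sum [Fintype E] (src tgt : E → V) (k : ℕ) [NeZero k] :
    phiR src tgt k =
      ∑ f : E → ZMod k, ∑ σ : E → Prop, if IsPhiPair src tgt k f σ then 1 else 0 := by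
  have h : phiR src tgt k =
      Nat.card {p : (E → ZMod k) × (E → Prop) // IsPhiPair src tgt k p.1 p.2} := by
    refine Nat.card_congr (Equiv.subtypeEquivRight fun p => ?_)
    rw [tcReorContr_iff]
    rfl
  rw [h, Nat.card_eq_fintype_card, Fintype.card_subtype, Finset.card_filter,
    Fintype.sum_prod_type]

theorem phiR_eq_sum_extend [Fintype E] (src tgt : E → V) (k : ℕ) [NeZero k] (e : E) :
    phiR src tgt k =
      ∑ f : {a : E // a ∉ ({e} : Set E)} → ZMod k, ∑ σ : {a : E // a ∉ ({e} : Set E)} → Prop,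
        ∑ t : ZMod k, ((if IsPhiPair src tgt k (extend e t f) (extend e True σ) then 1 else 0) +
          (if IsPhiPair src tgt k (extend e t f) (extend e False σ) then 1 else 0)) := by
  rw [phiR_eq_sum, ← (extendEquiv (ZMod k) e).sum_comp, Fintype.sum_prod_type]
  refine Finset.sum_congr rfl fun f _ => ?_
  refine Eq.trans ?_ Finset.sum_comm
  refine Finset.sum_congr rfl fun t _ => ?_
  rw [← (extendEquiv Prop e).sum_comp, Fintype.sum_prod_type]
  refine Finset.sum_congr rfl fun σ _ => ?_
  rw [Fintype.univ_Prop, Finset.sum_pair (by simp)]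
  rfl

theorem isFlow_extend_iff [Fintype E] (src tgt : E → V) (k : ℕ) (e : E)
    [Fintype {a : E // a ∉ ({e} : Set E)}]
    (t : ZMod k) (f : {a : E // a ∉ ({e} : Set E)} → ZMod k) :
    IsFlow src tgt k (extend e t f) ↔ ∀ v,
      (if tgt e = v then t else 0) + ∑ a : {a : E // a ∉ ({e} : Set E)},
          (if tgt a = v then f a else 0) =
        (if src e = v then t else 0) + ∑ a : {a : E // a ∉ ({e} : Set E)},
          (if src a = v then f a else 0) := by
  simp only [IsFlow, sum_edge e, extend_self, extend_coe]

theorem isFlow_extend_zero [Fintype E] (src tgt : E → V) (k : ℕ) (e : E)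
    [Fintype {a : E // a ∉ ({e} : Set E)}] (f : {a : E // a ∉ ({e} : Set E)} → ZMod k) :
    IsFlow src tgt k (extend e 0 f) ↔ IsFlow (dsrc src {e}) (dsrc tgt {e}) k f := by
  rw [isFlow_extend_iff]
  simp only [ite_self, zero_add]
  rfl

theorem isFlow_extend_loop [Fintype E] {src tgt : E → V} (k : ℕ) {e : E} (he : src e = tgt e)
    [Fintype {a : E // a ∉ ({e} : Set E)}] (t : ZMod k)
    (f : {a : E // a ∉ ({e} : Set E)} → ZMod k) :
    IsFlow src tgt k (extend e t f) ↔ IsFlow (dsrc src {e}) (dsrc tgt {e}) k f := by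
  rw [isFlow_extend_iff]
  simp only [he, add_right_inj]
  rfl

theorem IsFlow.map [Fintype V] [Fintype E] {src tgt : E → V} {k : ℕ} {f : E → ZMod k}
    (hf : IsFlow src tgt k f) {W : Type} (q : V → W) :
    IsFlow (fun a => q (src a)) (fun a => q (tgt a)) k f := by
  intro w
  have key : ∀ h : E → V, (∑ a, if q (h a) = w then f a else 0) =
      ∑ v : V, if q v = w then ∑ a, (if h a = v then f a else 0) else 0 := by
    intro h
    have hsum : ∀ a, (if q (h a) = w then f a else 0) =
        ∑ v, if h a = v then (if q v = w then f a else 0) else 0 := by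
      intro a
      rw [Finset.sum_ite_eq]
      simp
    rw [Finset.sum_congr rfl fun a _ => hsum a, Finset.sum_comm]
    refine Finset.sum_congr rfl fun v _ => ?_
    by_cases hv : q v = w <;> simp [hv]
  rw [key, key]
  simp only [hf _]

theorem mk_eq_mk_linkRel_singleton {src tgt : E → V} {e : E} {u v : V} :
    Quot.mk (linkRel src tgt {e}) u = Quot.mk (linkRel src tgt {e}) v ↔
      u = v ∨ ((u = src e ∨ u = tgt e) ∧ (v = src e ∨ v = tgt e)) := by
  constructor
  · intro h
    replace h := Quot.eqvGen_exact h
    induction h with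
    | rel u v h =>
      obtain ⟨_, rfl, rfl, rfl⟩ := h
      simp
    | refl => exact .inl rfl
    | symm _ _ _ ih => exact ih.imp Eq.symm And.symm
    | trans _ _ _ _ _ ih₁ ih₂ =>
      rcases ih₁ with rfl | h₁
      · exact ih₂
      rcases ih₂ with rfl | h₂
      · exact .inr h₁
      · exact .inr ⟨h₁.1, h₂.2⟩
  · have h : Quot.mk (linkRel src tgt {e}) (src e) = Quot.mk (linkRel src tgt {e}) (tgt e) :=
      Quot.sound ⟨e, rfl, rfl, rfl⟩
    rintro (rfl | ⟨rfl | rfl, rfl | rfl⟩) <;> simp [h]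

theorem isFlow_contract_of_extend [Fintype V] [Fintype E] {src tgt : E → V} {k : ℕ} {e : E}
    [Fintype {a : E // a ∉ ({e} : Set E)}] {t : ZMod k}
    {f : {a : E // a ∉ ({e} : Set E)} → ZMod k} (h : IsFlow src tgt k (extend e t f)) :
    IsFlow (csrc src tgt {e}) (ctgt src tgt {e}) k f := by
  have he : Quot.mk (linkRel src tgt {e}) (src e) = Quot.mk (linkRel src tgt {e}) (tgt e) :=
    Quot.sound ⟨e, rfl, rfl, rfl⟩
  exact (isFlow_extend_loop (src := fun a => Quot.mk (linkRel src tgt {e}) (src a))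
    (tgt := fun a => Quot.mk (linkRel src tgt {e}) (tgt a)) k he t f).1 (h.map _)

theorem exists_isFlow_extend_iff [Fintype V] [Fintype E] {src tgt : E → V} {k : ℕ} {e : E}
    (he : src e ≠ tgt e) [Fintype {a : E // a ∉ ({e} : Set E)}]
    {f : {a : E // a ∉ ({e} : Set E)} → ZMod k}
    (h : IsFlow (csrc src tgt {e}) (ctgt src tgt {e}) k f) :
    ∃ t₀, ∀ t, IsFlow src tgt k (extend e t f) ↔ t = t₀ := by
  let inflow : V → ZMod k := fun v => ∑ a : {a : E // a ∉ ({e} : Set E)},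
    if tgt a = v then f a else 0
  let outflow : V → ZMod k := fun v => ∑ a : {a : E // a ∉ ({e} : Set E)},
    if src a = v then f a else 0
  have hne : ∀ v, v ≠ src e → v ≠ tgt e → inflow v = outflow v := by
    intro v h₁ h₂
    have := h (Quot.mk _ v)
    simpa [csrc, ctgt, mk_eq_mk_linkRel_singleton, h₁, h₂] using this
  have hsum : ∀ g : E → V, (∑ a : {a : E // a ∉ ({e} : Set E)},
      if Quot.mk (linkRel src tgt {e}) (g a) = Quot.mk (linkRel src tgt {e}) (src e)
        then f a else 0) =
      (∑ a : {a : E // a ∉ ({e} : Set E)}, if g a = src e then f a else 0) +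
      ∑ a : {a : E // a ∉ ({e} : Set E)}, if g a = tgt e then f a else 0 := by
    intro g
    rw [← Finset.sum_add_distrib]
    refine Finset.sum_congr rfl fun a _ => ?_
    by_cases h₁ : g a = src e
    · simp [h₁, he]
    · simp [mk_eq_mk_linkRel_singleton, h₁]
  have hpair : inflow (src e) + inflow (tgt e) = outflow (src e) + outflow (tgt e) :=
    (hsum tgt).symm.trans ((h (Quot.mk _ (src e))).trans (hsum src))
  refine ⟨inflow (src e) - outflow (src e), fun t => ?_⟩
  rw [isFlow_extend_iff]
  change (∀ v, (if tgt e = v then t else 0) + inflow v =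
    (if src e = v then t else 0) + outflow v) ↔ _
  constructor
  · intro h
    have := h (src e)
    rw [if_neg he.symm, if_pos rfl] at this
    linear_combination -this
  · rintro rfl v
    by_cases h₁ : v = src e
    · subst h₁
      rw [if_neg he.symm, if_pos rfl]
      ring
    by_cases h₂ : v = tgt e
    · subst h₂
      rw [if_neg he, if_pos rfl]
      linear_combination hpair
    · rw [if_neg (Ne.symm h₁), if_neg (Ne.symm h₂), hne v h₁ h₂]

end Flow

section Connectivity

open Relation

theorem eqvGen_linkRel_of_not_isColoop [Finite V] {src tgt : E → V} {e : E}
    (h : ¬ IsColoop src tgt e) : EqvGen (linkRel src tgt {e}ᶜ) (src e) (tgt e) := by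
  by_contra hxy
  apply h
  rw [IsColoop, ncomp, ncompSub, ncompSub]
  have hne : Quot.mk (linkRel src tgt {e}ᶜ) (src e) ≠ Quot.mk (linkRel src tgt {e}ᶜ) (tgt e) :=
    fun h => hxy (Quot.eqvGen_exact h)
  let g : Quot (linkRel src tgt Set.univ) →
      {q : Quot (linkRel src tgt {e}ᶜ) // q ≠ Quot.mk _ (tgt e)} :=
    Quot.lift (fun v => if hv : Quot.mk (linkRel src tgt {e}ᶜ) v = Quot.mk _ (tgt e)
      then ⟨Quot.mk _ (src e), hne⟩ else ⟨Quot.mk _ v, hv⟩) (by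
        rintro _ _ ⟨a, -, rfl, rfl⟩
        by_cases ha : a = e
        · subst ha
          simp [hne]
        · have : Quot.mk (linkRel src tgt {e}ᶜ) (src a) = Quot.mk _ (tgt a) :=
            Quot.sound ⟨a, ha, rfl, rfl⟩
          simp only [this])
  let i : Quot (linkRel src tgt {e}ᶜ) → Quot (linkRel src tgt Set.univ) :=
    Quot.map id (fun _ _ ⟨a, _, h⟩ => ⟨a, trivial, h⟩)
  have hcard := Nat.card_congr (Equiv.mk g (fun q => i q.1)
    (by
      rintro ⟨v⟩
      change i (g (Quot.mk _ v)).1 = Quot.mk _ v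
      by_cases hv : Quot.mk (linkRel src tgt {e}ᶜ) v = Quot.mk _ (tgt e)
      · have hi : Quot.mk (linkRel src tgt Set.univ) v = Quot.mk _ (tgt e) := congrArg i hv
        simp only [g, hv, dif_pos]
        rw [hi]
        exact Quot.sound ⟨e, trivial, rfl, rfl⟩
      · simp only [g, hv, dif_neg, not_false_eq_true]
        rfl)
    (by
      rintro ⟨⟨v⟩, hv⟩
      change g (Quot.mk _ v) = _
      exact dif_neg hv))
  have : Finite (Quot (linkRel src tgt {e}ᶜ)) := inferInstance
  rw [hcard]
  have := Fintype.ofFinite (Quot (linkRel src tgt {e}ᶜ))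
  have hpos : 0 < Fintype.card (Quot (linkRel src tgt {e}ᶜ)) :=
    Fintype.card_pos_iff.2 ⟨Quot.mk _ (src e)⟩
  rw [Nat.card_eq_fintype_card, Nat.card_eq_fintype_card, Fintype.card_subtype_compl,
    Fintype.card_subtype_eq]
  omega

theorem not_eqvGen_linkRel_of_isColoop [Finite V] {src tgt : E → V} {e : E}
    (h : IsColoop src tgt e) : ¬ EqvGen (linkRel src tgt {e}ᶜ) (src e) (tgt e) := by
  intro hxy
  have hcard : Nat.card (Quot (linkRel src tgt {e}ᶜ)) =
      Nat.card (Quot (linkRel src tgt Set.univ)) := by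
    refine Nat.card_congr (Equiv.mk (Quot.map id fun _ _ ⟨a, _, h⟩ => ⟨a, trivial, h⟩)
      (Quot.lift (Quot.mk _) ?_) (by rintro ⟨v⟩; rfl) (by rintro ⟨v⟩; rfl))
    rintro _ _ ⟨a, -, rfl, rfl⟩
    by_cases ha : a = e
    · subst ha
      exact Quot.eqvGen_sound hxy
    · exact Quot.sound ⟨a, ha, rfl, rfl⟩
  rw [IsColoop, ncomp, ncompSub, ncompSub, hcard] at h
  omega

theorem eqvGen_mixedStep_iff {src tgt : E → V} {e : E} {S σ : Set {a : E // a ∉ ({e} : Set E)}}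
    {u v : V} : EqvGen (mixedStep (dsrc src {e}) (dsrc tgt {e}) S σ) u v ↔
      EqvGen (linkRel src tgt {e}ᶜ) u v := by
  constructor <;> intro h
  · induction h with
    | rel _ _ h =>
      obtain ⟨a, ⟨h₁, h₂, -⟩ | ⟨h₁, h₂, -⟩⟩ := h
      · exact .rel _ _ ⟨a, a.2, h₁, h₂⟩
      · exact .symm _ _ (.rel _ _ ⟨a, a.2, h₂, h₁⟩)
    | refl => exact .refl _
    | symm _ _ _ ih => exact .symm _ _ ih
    | trans _ _ _ _ _ ih₁ ih₂ => exact .trans _ _ _ ih₁ ih₂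
  · induction h with
    | rel _ _ h =>
      obtain ⟨a, ha, h₁, h₂⟩ := h
      by_cases hσ : (⟨a, ha⟩ : {a : E // a ∉ ({e} : Set E)}) ∈ σ
      · exact .symm _ _ (.rel _ _ ⟨⟨a, ha⟩, .inr ⟨h₂, h₁, .inr hσ⟩⟩)
      · exact .rel _ _ ⟨⟨a, ha⟩, .inl ⟨h₁, h₂, .inr hσ⟩⟩
    | refl => exact .refl _
    | symm _ _ _ ih => exact .symm _ _ ih
    | trans _ _ _ _ _ ih₁ ih₂ => exact .trans _ _ _ ih₁ ih₂

theorem IsFlow.eq_zero_of_isColoop [Fintype V] [Fintype E] {src tgt : E → V} {k : ℕ}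
    {f : E → ZMod k} (hf : IsFlow src tgt k f) {e : E} (h : IsColoop src tgt e) : f e = 0 := by
  have hne : Quot.mk (linkRel src tgt {e}ᶜ) (tgt e) ≠ Quot.mk (linkRel src tgt {e}ᶜ) (src e) :=
    fun h' => not_eqvGen_linkRel_of_isColoop h (Quot.eqvGen_exact h'.symm)
  have key := hf.map (Quot.mk (linkRel src tgt {e}ᶜ)) (Quot.mk _ (src e))
  rw [sum_edge e, sum_edge e, if_neg hne, if_pos rfl, zero_add] at key
  have hsum : ∀ a : {a : E // a ∉ ({e} : Set E)},
      Quot.mk (linkRel src tgt {e}ᶜ) (tgt a) = Quot.mk (linkRel src tgt {e}ᶜ) (src a) :=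
    fun a => (Quot.sound ⟨a, a.2, rfl, rfl⟩).symm
  simp only [hsum] at key
  exact right_eq_add.1 key |>.symm ▸ rfl

end Connectivity

section DeletionContraction

open Relation

theorem mixedStep_extend {src tgt : E → V} {k : ℕ} {e : E} (t : ZMod k) (b : Prop)
    (f : {a : E // a ∉ ({e} : Set E)} → ZMod k) (σ : {a : E // a ∉ ({e} : Set E)} → Prop)
    (u v : V) :
    mixedStep src tgt {a | extend e t f a ≠ 0} {a | extend e b σ a} u v ↔
      ((mixedStep (dsrc src {e}) (dsrc tgt {e}) {a | f a ≠ 0} {a | σ a} u v ∨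
        ((t ≠ 0 ∨ ¬ b) ∧ u = src e ∧ v = tgt e)) ∨
        ((t ≠ 0 ∨ b) ∧ u = tgt e ∧ v = src e)) := by
  rw [mixedStep, exists_edge_iff e]
  simp only [mixedStep, Set.mem_ofPred_eq, extend_self, extend_coe, dsrc]
  rw [eq_comm (a := u) (b := src e), eq_comm (a := u) (b := tgt e),
    eq_comm (a := v) (b := src e), eq_comm (a := v) (b := tgt e)]
  constructor
  · rintro ((⟨h₁, h₂, h₃⟩ | ⟨h₁, h₂, h₃⟩) | h)
    · exact .inl (.inr ⟨h₃, h₁, h₂⟩)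
    · exact .inr ⟨h₃, h₁, h₂⟩
    · exact .inl (.inl h)
  · rintro ((h | ⟨h₃, h₁, h₂⟩) | ⟨h₃, h₁, h₂⟩)
    · exact .inr h
    · exact .inl (.inl ⟨h₁, h₂, h₃⟩)
    · exact .inl (.inr ⟨h₁, h₂, h₃⟩)

theorem mixedStep_extend_of_ne {src tgt : E → V} {k : ℕ} {e : E} {t : ZMod k} (ht : t ≠ 0)
    (b : Prop) (f : {a : E // a ∉ ({e} : Set E)} → ZMod k)
    (σ : {a : E // a ∉ ({e} : Set E)} → Prop) :
    mixedStep src tgt {a | extend e t f a ≠ 0} {a | extend e b σ a} =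
      addStep (addStep (mixedStep (dsrc src {e}) (dsrc tgt {e}) {a | f a ≠ 0} {a | σ a})
        (src e) (tgt e)) (tgt e) (src e) := by
  funext u v
  simp [mixedStep_extend, addStep, ht]

theorem mixedStep_extend_zero_true {src tgt : E → V} {k : ℕ} {e : E}
    (f : {a : E // a ∉ ({e} : Set E)} → ZMod k) (σ : {a : E // a ∉ ({e} : Set E)} → Prop) :
    mixedStep src tgt {a | extend e 0 f a ≠ 0} {a | extend e True σ a} =
      addStep (mixedStep (dsrc src {e}) (dsrc tgt {e}) {a | f a ≠ 0} {a | σ a}) (tgt e) (src e) := by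
  funext u v
  simp [mixedStep_extend, addStep]

theorem mixedStep_extend_zero_false {src tgt : E → V} {k : ℕ} {e : E}
    (f : {a : E // a ∉ ({e} : Set E)} → ZMod k) (σ : {a : E // a ∉ ({e} : Set E)} → Prop) :
    mixedStep src tgt {a | extend e 0 f a ≠ 0} {a | extend e False σ a} =
      addStep (mixedStep (dsrc src {e}) (dsrc tgt {e}) {a | f a ≠ 0} {a | σ a}) (src e) (tgt e) := by
  funext u v
  simp [mixedStep_extend, addStep]

theorem extend_imp_iff {k : ℕ} {e : E} (t : ZMod k) (b : Prop)
    (f : {a : E // a ∉ ({e} : Set E)} → ZMod k) (σ : {a : E // a ∉ ({e} : Set E)} → Prop) :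
    (∀ a, extend e b σ a → extend e t f a = 0) ↔ (b → t = 0) ∧ ∀ a, σ a → f a = 0 := by
  rw [forall_edge_iff e]
  simp only [extend_self, extend_coe]

theorem isReversible_mixedStep_contract {src tgt : E → V} {e : E}
    (S σ : Set {a : E // a ∉ ({e} : Set E)}) :
    IsReversible (mixedStep (csrc src tgt {e}) (ctgt src tgt {e}) S σ) ↔
      IsReversible (addStep (addStep (mixedStep (dsrc src {e}) (dsrc tgt {e}) S σ)
        (src e) (tgt e)) (tgt e) (src e)) := by
  have h : mixedStep (csrc src tgt {e}) (ctgt src tgt {e}) S σ =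
      Relation.Map (mixedStep (dsrc src {e}) (dsrc tgt {e}) S σ)
        (Quot.mk (linkRel src tgt {e})) (Quot.mk (linkRel src tgt {e})) := by
    funext p q
    apply propext
    constructor
    · rintro ⟨a, ⟨rfl, rfl, h⟩ | ⟨rfl, rfl, h⟩⟩
      · exact ⟨src a, tgt a, ⟨a, .inl ⟨rfl, rfl, h⟩⟩, rfl, rfl⟩
      · exact ⟨tgt a, src a, ⟨a, .inr ⟨rfl, rfl, h⟩⟩, rfl, rfl⟩
    · rintro ⟨_, _, ⟨a, ⟨rfl, rfl, h⟩ | ⟨rfl, rfl, h⟩⟩, rfl, rfl⟩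
      · exact ⟨a, .inl ⟨rfl, rfl, h⟩⟩
      · exact ⟨a, .inr ⟨rfl, rfl, h⟩⟩
  rw [h]
  apply isReversible_map_quot
  intro u v
  have hl : ∀ u v, linkRel src tgt {e} u v ↔ u = src e ∧ v = tgt e := fun u v =>
    ⟨by rintro ⟨_, rfl, rfl, rfl⟩; exact ⟨rfl, rfl⟩, by rintro ⟨rfl, rfl⟩; exact ⟨e, rfl, rfl, rfl⟩⟩
  rw [hl, hl, addStep, addStep]
  tauto

theorem phiR_of_isEmpty [Fintype E] [IsEmpty E] (src tgt : E → V) (k : ℕ) :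
    phiR src tgt k = 1 := by
  rw [phiR, Nat.card_eq_one_iff_unique]
  refine ⟨⟨fun p q => Subtype.ext (Prod.ext (Subsingleton.elim _ _) (Subsingleton.elim _ _))⟩,
    ⟨⟨(fun _ => 0, ∅), fun v => by simp, by simp, fun a => isEmptyElim a.1⟩⟩⟩

theorem phiR_of_isColoop [Fintype V] [Fintype E] {src tgt : E → V} (k : ℕ) [NeZero k] {e : E}
    (he : IsColoop src tgt e) : phiR src tgt k = 0 := by
  have hne := not_eqvGen_linkRel_of_isColoop he
  rw [phiR_eq_sum_extend src tgt k e]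
  refine Finset.sum_eq_zero fun f _ => Finset.sum_eq_zero fun σ _ =>
    Finset.sum_eq_zero fun t _ => ?_
  have htrue : ¬ IsPhiPair src tgt k (extend e t f) (extend e True σ) := by
    rintro ⟨hf, -, h⟩
    obtain rfl : t = 0 := by simpa using hf.eq_zero_of_isColoop he
    rw [mixedStep_extend_zero_true] at h
    apply hne
    rw [← eqvGen_mixedStep_iff (S := {a | f a ≠ 0}) (σ := {a | σ a})]
    have := reflTransGen_addStep (h _ _ (.inr ⟨rfl, rfl⟩))
    exact eqvGen_of_reflTransGen (this.elim id And.left)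
  have hfalse : ¬ IsPhiPair src tgt k (extend e t f) (extend e False σ) := by
    rintro ⟨hf, -, h⟩
    obtain rfl : t = 0 := by simpa using hf.eq_zero_of_isColoop he
    rw [mixedStep_extend_zero_false] at h
    apply hne
    rw [← eqvGen_mixedStep_iff (S := {a | f a ≠ 0}) (σ := {a | σ a})]
    have := reflTransGen_addStep (h _ _ (.inr ⟨rfl, rfl⟩))
    exact (eqvGen_of_reflTransGen (this.elim id And.left)).symm
  rw [if_neg htrue, if_neg hfalse, add_zero]

theorem phiR_of_loop [Fintype E] {src tgt : E → V} (k : ℕ) [NeZero k] {e : E}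
    (he : src e = tgt e) [Fintype {a : E // a ∉ ({e} : Set E)}] :
    phiR src tgt k = (k + 1) * phiR (dsrc src {e}) (dsrc tgt {e}) k := by
  rw [phiR_eq_sum_extend src tgt k e, phiR_eq_sum, Finset.mul_sum]
  refine Finset.sum_congr (by congr!) fun f _ => ?_
  rw [Finset.mul_sum]
  refine Finset.sum_congr (by congr!) fun σ _ => ?_
  have hfalse : ∀ t : ZMod k, IsPhiPair src tgt k (extend e t f) (extend e False σ) ↔
      IsPhiPair (dsrc src {e}) (dsrc tgt {e}) k f σ := by
    intro t
    rw [IsPhiPair, IsPhiPair, isFlow_extend_loop k he, extend_imp_iff, false_imp_iff, true_and]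
    by_cases ht : t = 0
    · subst ht
      rw [mixedStep_extend_zero_false, he, isReversible_addStep_self]
    · rw [mixedStep_extend_of_ne ht, he, isReversible_addStep_self, isReversible_addStep_self]
  have htrue : ∀ t : ZMod k, IsPhiPair src tgt k (extend e t f) (extend e True σ) ↔
      t = 0 ∧ IsPhiPair (dsrc src {e}) (dsrc tgt {e}) k f σ := by
    intro t
    rw [IsPhiPair, IsPhiPair, isFlow_extend_loop k he, extend_imp_iff, true_imp_iff]
    by_cases ht : t = 0
    · subst ht
      rw [mixedStep_extend_zero_true, he, isReversible_addStep_self]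
      tauto
    · tauto
  simp only [hfalse, htrue, Finset.sum_add_distrib]
  by_cases h : IsPhiPair (dsrc src {e}) (dsrc tgt {e}) k f σ
  · simp [h, ZMod.card, add_comm]
  · simp [h]

theorem phiR_eq_delete_add_contract [Fintype V] [Fintype E] {src tgt : E → V} (k : ℕ) [NeZero k]
    {e : E} (he : src e ≠ tgt e) (hc : ¬ IsColoop src tgt e)
    [Fintype {a : E // a ∉ ({e} : Set E)}] :
    phiR src tgt k = phiR (dsrc src {e}) (dsrc tgt {e}) k +
      phiR (csrc src tgt {e}) (ctgt src tgt {e}) k := by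
  rw [phiR_eq_sum_extend src tgt k e, phiR_eq_sum, phiR_eq_sum, ← Finset.sum_add_distrib]
  refine Finset.sum_congr (by congr!) fun f _ => ?_
  rw [← Finset.sum_add_distrib]
  refine Finset.sum_congr (by congr!) fun σ _ => ?_
  by_cases hcontr : IsFlow (csrc src tgt {e}) (ctgt src tgt {e}) k f
  swap
  · have hf : ∀ t, ¬ IsFlow src tgt k (extend e t f) :=
      fun t ht => hcontr (isFlow_contract_of_extend ht)
    have hdel := hf 0
    rw [isFlow_extend_zero] at hdel
    simp [IsPhiPair, hcontr, hf, hdel]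
  obtain ⟨t₀, ht₀⟩ := exists_isFlow_extend_iff he hcontr
  rw [Finset.sum_eq_single t₀ (fun t _ ht => by simp [IsPhiPair, ht₀, ht]) (by simp)]
  by_cases hσ : ∀ a, σ a → f a = 0
  swap
  · simp only [IsPhiPair, extend_imp_iff, hσ, and_false, false_and, if_false]
  have hdel := isFlow_extend_zero src tgt k e f
  rw [ht₀] at hdel
  simp only [IsPhiPair, extend_imp_iff, eq_true hσ, and_true, true_and, hcontr, ← hdel, ht₀,
    isReversible_mixedStep_contract, true_imp_iff, false_imp_iff]
  by_cases h₀ : t₀ = 0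
  · subst h₀
    simp only [true_and, mixedStep_extend_zero_true, mixedStep_extend_zero_false]
    exact isReversible_addStep_count
      (eqvGen_mixedStep_iff.2 (eqvGen_linkRel_of_not_isColoop hc))
  · simp only [h₀, Ne.symm h₀, false_and, if_false, mixedStep_extend_of_ne h₀]

end DeletionContraction

/-- Deletion–contraction for the pair count `φ⁻_G(k)` (number of pairs of a
`ZMod k`-flow and a totally cyclic reorientation of the contraction of its
support): (1) it is `1` on edgeless graphs, (2) `0` if there is a coloop,
(3) a loop contributes a factor `k+1`, (4) otherwise deletion–contraction. -/
theorem phiR_deletion_contraction {V E : Type} [Fintype V] [Fintype E]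
    (src tgt : E → V) (k : ℕ) (hk : 0 < k) :
    (IsEmpty E → phiR src tgt k = 1) ∧
    (∀ e : E, IsColoop src tgt e → phiR src tgt k = 0) ∧
    (∀ e : E, src e = tgt e →
      phiR src tgt k =
        (k + 1) * phiR (dsrc src ({e} : Set E)) (dsrc tgt ({e} : Set E)) k) ∧
    (∀ e : E, src e ≠ tgt e → ¬ IsColoop src tgt e →
      phiR src tgt k =
        phiR (dsrc src ({e} : Set E)) (dsrc tgt ({e} : Set E)) k +
        phiR (csrc src tgt ({e} : Set E)) (ctgt src tgt ({e} : Set E)) k) := by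
  have : NeZero k := ⟨hk.ne'⟩
  exact ⟨fun _ => phiR_of_isEmpty src tgt k, fun _ he => phiR_of_isColoop k he,
    fun _ he => phiR_of_loop k he, fun _ he hc => phiR_eq_delete_add_contract k he hc⟩

end ModularFlows
end

section
/- Let G = (V,E) be an oriented graph and e ∈ E an edge that is neither a loop nor a coloop. If f is a Z_k-flow on G, then the restriction of f to E \ {e} is (1) a Z_k-flow on the contraction G_/e, and (2) a Z_k-flow on the deletion G_∖e if and only if f(e) = 0. -/
namespace ModularFlows

attribute [local instance] Classical.propDecidable

variable {V E : Type}

/-- Flows push forward along any identification of vertices. -/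
theorem IsFlow.map_vertices {V W E : Type} [Fintype V] [Fintype E] {src tgt : E → V} {k : ℕ}
    {f : E → ZMod k} (hf : IsFlow src tgt k f) (q : V → W) :
    IsFlow (fun e => q (src e)) (fun e => q (tgt e)) k f := by
  have fiber_sum (s : E → V) (w : W) : (∑ e : E, if q (s e) = w then f e else 0) =
      ∑ v : V, if q v = w then ∑ e : E, if s e = v then f e else 0 else 0 := by
    simp only [← Finset.sum_filter (fun v => q v = w)]
    rw [Finset.sum_comm]
    refine Finset.sum_congr rfl fun e _ => ?_
    rw [Finset.sum_ite_eq]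
    simp
  intro w
  rw [fiber_sum, fiber_sum]
  exact Finset.sum_congr rfl fun v _ => by rw [hf v]

/-- A sum over all edges splits into the edge `e` and the edges other than `e`. -/
theorem sum_eq_add_sum_notMem_singleton {E M : Type*} [Fintype E] [AddCommMonoid M] (e : E)
    [Fintype {e' : E // e' ∉ ({e} : Set E)}] (g : E → M) :
    ∑ e' : E, g e' = g e + ∑ e' : {e' : E // e' ∉ ({e} : Set E)}, g e'.1 := by
  rw [Fintype.sum_eq_add_sum_compl e g]
  congr 1
  exact Finset.sum_subtype _ (by simp) g

/-- Removing the edge `e` from a flow `f` leaves a flow exactly when `e` contributes equally to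
the inflow and the outflow of every vertex. -/
theorem IsFlow.restrict_iff {V E : Type} [Fintype E] {src tgt : E → V} {k : ℕ}
    {f : E → ZMod k} (hf : IsFlow src tgt k f) (e : E) :
    IsFlow (fun e' : {e' : E // e' ∉ ({e} : Set E)} => src e'.1) (fun e' => tgt e'.1) k
      (fun e' => f e'.1) ↔
    ∀ v, (if tgt e = v then f e else 0) = if src e = v then f e else 0 := by
  refine forall_congr' fun v => ?_
  have h := hf v
  rw [sum_eq_add_sum_notMem_singleton e, sum_eq_add_sum_notMem_singleton e] at h
  constructor
  · intro h'
    rw [h'] at h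
    exact add_right_cancel h
  · intro h'
    rw [h'] at h
    exact add_left_cancel h

/-- If `e` is neither a loop nor a coloop and `f` is a `ZMod k`-flow on `G`,
then the restriction of `f` to `E ∖ {e}` is (1) a `ZMod k`-flow on the
contraction `G/e`, and (2) a `ZMod k`-flow on the deletion `G∖e` iff `f e = 0`. -/
theorem flow_projection {V E : Type} [Fintype V] [Fintype E]
    (src tgt : E → V) (e : E)
    (hloop : src e ≠ tgt e) (hcoloop : ¬ IsColoop src tgt e)
    (k : ℕ) (hk : 0 < k) (f : E → ZMod k) (hf : IsFlow src tgt k f) :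
    IsFlow (csrc src tgt ({e} : Set E)) (ctgt src tgt ({e} : Set E)) k
      (fun e' => f e'.1) ∧
    (IsFlow (dsrc src ({e} : Set E)) (dsrc tgt ({e} : Set E)) k
        (fun e' => f e'.1) ↔ f e = 0) := by
  constructor
  · refine ((hf.map_vertices (Quot.mk (linkRel src tgt {e}))).restrict_iff e).2 fun v => ?_
    rw [Quot.sound (show linkRel src tgt {e} (src e) (tgt e) from ⟨e, rfl, rfl, rfl⟩)]
  · refine (hf.restrict_iff e).trans ⟨fun h => ?_, fun h v => by simp [h]⟩
    simpa [hloop] using h (tgt e)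

end ModularFlows
end

section
/- Let G = (V,E) be an oriented graph and e ∈ E an edge that is neither a loop nor a coloop. Then: (1) for every Z_k-flow f′ on the contraction G_/e there exists a unique Z_k-flow f on G whose restriction to E \ {e} equals f′; (2) for every Z_k-flow f′ on the deletion G_∖e there exists a unique Z_k-flow f on G whose restriction to E \ {e} equals f′, and this flow satisfies f(e) = 0. -/
namespace ModularFlows

attribute [local instance] Classical.propDecidable

variable {V E : Type}

/-- Splitting off the term of one edge in the conservation sums. -/
theorem sum_ite_eq_add_sum_compl [Fintype E] {M : Type*} [AddCommMonoid M] (t : E → V) (e : E)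
    (f : E → M) (v : V) :
    (∑ x : E, if t x = v then f x else 0) =
      (if t e = v then f e else 0) +
        ∑ x : {x : E // x ∉ ({e} : Set E)}, if t x.1 = v then f x.1 else 0 := by
  rw [Fintype.sum_eq_add_sum_subtype_ne (fun x => if t x = v then f x else 0) e]
  congr 1

/-- A flow on `G`, expressed through a prescribed restriction to `E ∖ {e}`. -/
theorem isFlow_iff_of_restrict [Fintype E] (src tgt : E → V) (e : E) (k : ℕ) (f : E → ZMod k)
    (f' : {x : E // x ∉ ({e} : Set E)} → ZMod k) (h : ∀ x, f x.1 = f' x) :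
    IsFlow src tgt k f ↔ ∀ v : V,
      (if tgt e = v then f e else 0) + (∑ x, if tgt x.1 = v then f' x else 0) =
        (if src e = v then f e else 0) + ∑ x, if src x.1 = v then f' x else 0 := by
  unfold IsFlow
  refine forall_congr' fun v => ?_
  rw [sum_ite_eq_add_sum_compl tgt e f v, sum_ite_eq_add_sum_compl src e f v]
  simp only [h]

/-- Flows on `G` agreeing off a non-loop edge are equal. -/
theorem isFlow_eq_of_restrict_eq [Fintype E] (src tgt : E → V) (e : E) (hloop : src e ≠ tgt e)
    (k : ℕ) (f g : E → ZMod k) (hf : IsFlow src tgt k f) (hg : IsFlow src tgt k g)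
    (h : ∀ x : {x : E // x ∉ ({e} : Set E)}, f x.1 = g x.1) : f = g := by
  have h1 := (isFlow_iff_of_restrict src tgt e k f _ h).1 hf (tgt e)
  have h2 := (isFlow_iff_of_restrict src tgt e k g _ (fun _ => rfl)).1 hg (tgt e)
  have he : f e = g e := by
    rw [if_pos rfl, if_neg hloop] at h1 h2
    exact add_right_cancel (h1.trans h2.symm)
  funext x
  by_cases hx : x = e
  · rw [hx, he]
  · exact h ⟨x, hx⟩

/-- In the contraction of `e`, the classes of vertices coincide exactly when the vertices are
equal or both are ends of `e`. -/
theorem quot_mk_eq_iff (src tgt : E → V) (e : E) (x y : V) :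
    Quot.mk (linkRel src tgt ({e} : Set E)) x = Quot.mk _ y ↔
      x = y ∨ (x = src e ∨ x = tgt e) ∧ (y = src e ∨ y = tgt e) := by
  have hst : Quot.mk (linkRel src tgt ({e} : Set E)) (src e) = Quot.mk _ (tgt e) :=
    Quot.sound ⟨e, rfl, rfl, rfl⟩
  constructor
  · intro h
    have hp := congrArg (Quot.lift (fun w => if w = tgt e then src e else w) (by
      rintro _ _ ⟨e', rfl, rfl, rfl⟩
      simp)) h
    simp only at hp
    grind
  · rintro (rfl | ⟨rfl | rfl, rfl | rfl⟩)
    · rfl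
    · rfl
    · exact hst
    · exact hst.symm
    · rfl

/-- Extension of a function on `E ∖ {e}` by the value `c` at `e`. -/
noncomputable def extendAt {M : Type*} (e : E) (c : M) (f' : {x : E // x ∉ ({e} : Set E)} → M)
    (x : E) : M :=
  if h : x = e then c else f' ⟨x, h⟩

theorem extendAt_self {M : Type*} (e : E) (c : M)
    (f' : {x : E // x ∉ ({e} : Set E)} → M) : extendAt e c f' e = c := by
  simp [extendAt]

theorem extendAt_coe {M : Type*} (e : E) (c : M)
    (f' : {x : E // x ∉ ({e} : Set E)} → M) (x : {x : E // x ∉ ({e} : Set E)}) :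
    extendAt e c f' x.1 = f' x :=
  dif_neg x.2

/-- Every flow on the contraction of a non-loop edge extends to a flow on `G`. -/
theorem exists_isFlow_of_contraction [Fintype E] (src tgt : E → V) (e : E)
    (hloop : src e ≠ tgt e) (k : ℕ) (f' : {x : E // x ∉ ({e} : Set E)} → ZMod k)
    (hf' : IsFlow (csrc src tgt ({e} : Set E)) (ctgt src tgt ({e} : Set E)) k f') :
    ∃ f : E → ZMod k, IsFlow src tgt k f ∧ ∀ x, f x.1 = f' x := by
  set A : V → ZMod k := fun v => ∑ x, if tgt x.1 = v then f' x else 0 with hA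
  set B : V → ZMod k := fun v => ∑ x, if src x.1 = v then f' x else 0 with hB
  have hne : ∀ v, v ≠ src e → v ≠ tgt e → A v = B v := by
    intro v h1 h2
    have h := hf' (Quot.mk _ v)
    simpa [csrc, ctgt, quot_mk_eq_iff, h1, h2] using h
  have hab : A (src e) + A (tgt e) = B (src e) + B (tgt e) := by
    have h := hf' (Quot.mk _ (src e))
    simp only [csrc, ctgt, quot_mk_eq_iff] at h
    simp only [hA, hB, ← Finset.sum_add_distrib]
    convert h using 2 <;> grind
  refine ⟨extendAt e (B (tgt e) - A (tgt e)) f', ?_, extendAt_coe e _ f'⟩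
  rw [isFlow_iff_of_restrict src tgt e k _ f' (extendAt_coe e _ f')]
  intro v
  change _ + A v = _ + B v
  rw [extendAt_self]
  by_cases h1 : v = src e
  · subst h1
    rw [if_neg hloop.symm, if_pos rfl]
    linear_combination hab
  · by_cases h2 : v = tgt e
    · subst h2
      rw [if_neg hloop, if_pos rfl]
      ring
    · rw [if_neg (Ne.symm h1), if_neg (Ne.symm h2), hne v h1 h2]

/-- Extending a flow on the deletion of `e` by zero gives a flow on `G`. -/
theorem isFlow_extendAt_zero [Fintype E] (src tgt : E → V) (e : E) (k : ℕ)
    (f' : {x : E // x ∉ ({e} : Set E)} → ZMod k)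
    (hf' : IsFlow (dsrc src ({e} : Set E)) (dsrc tgt ({e} : Set E)) k f') :
    IsFlow src tgt k (extendAt e 0 f') := by
  rw [isFlow_iff_of_restrict src tgt e k _ f' (extendAt_coe e _ f')]
  intro v
  simp only [extendAt_self, ite_self, zero_add]
  exact hf' v

/-- If `e` is neither a loop nor a coloop, then (1) every `ZMod k`-flow on the
contraction `G/e` lifts to a unique `ZMod k`-flow on `G`, and (2) every
`ZMod k`-flow on the deletion `G∖e` lifts to a unique `ZMod k`-flow on `G`,
which moreover vanishes on `e`. -/
theorem flow_lifting {V E : Type} [Fintype V] [Fintype E]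
    (src tgt : E → V) (e : E)
    (hloop : src e ≠ tgt e) (hcoloop : ¬ IsColoop src tgt e)
    (k : ℕ) (hk : 0 < k) :
    (∀ f' : {e' : E // e' ∉ ({e} : Set E)} → ZMod k,
      IsFlow (csrc src tgt ({e} : Set E)) (ctgt src tgt ({e} : Set E)) k f' →
      ∃! f : E → ZMod k, IsFlow src tgt k f ∧ ∀ e', f e'.1 = f' e') ∧
    (∀ f' : {e' : E // e' ∉ ({e} : Set E)} → ZMod k,
      IsFlow (dsrc src ({e} : Set E)) (dsrc tgt ({e} : Set E)) k f' →
      (∃! f : E → ZMod k, IsFlow src tgt k f ∧ ∀ e', f e'.1 = f' e') ∧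
      (∀ f : E → ZMod k, IsFlow src tgt k f → (∀ e', f e'.1 = f' e') → f e = 0)) := by
  have huniq : ∀ (f' : {e' : E // e' ∉ ({e} : Set E)} → ZMod k) (f g : E → ZMod k),
      (IsFlow src tgt k f ∧ ∀ e', f e'.1 = f' e') →
      (IsFlow src tgt k g ∧ ∀ e', g e'.1 = f' e') → f = g := fun f' f g hf hg =>
    isFlow_eq_of_restrict_eq src tgt e hloop k f g hf.1 hg.1
      fun x => (hf.2 x).trans (hg.2 x).symm
  refine ⟨fun f' hf' => ?_, fun f' hf' => ?_⟩
  · obtain ⟨f, hf⟩ := exists_isFlow_of_contraction src tgt e hloop k f' hf'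
    exact ⟨f, hf, fun g hg => huniq f' g f hg hf⟩
  · have h0 := And.intro (isFlow_extendAt_zero src tgt e k f' hf') (extendAt_coe e 0 f')
    refine ⟨⟨_, h0, fun g hg => huniq f' g _ hg h0⟩, fun f hf hr => ?_⟩
    rw [huniq f' f _ ⟨hf, hr⟩ h0, extendAt_self]

end ModularFlows
end

section
/- Let G = (V,E) be an oriented graph, e ∈ E an edge that is neither a loop nor a coloop, and σ ⊆ E a totally cyclic reorientation of G. Then: (1) σ ∩ (E \ {e}) is a totally cyclic reorientation of the contraction G_/e; (2) σ ∩ (E \ {e}) is a totally cyclic reorientation of the deletion G_∖e if and only if both σ and σ Δ {e} (the symmetric difference) are totally cyclic reorientations of G. -/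
namespace ModularFlows

attribute [local instance] Classical.propDecidable

variable {V E : Type}

open Relation

/-- There is a directed walk with exactly `n` edges from the given vertex to `z`. -/
def HasWalk (src tgt : E → V) (z : V) : ℕ → V → Prop
  | 0, x => x = z
  | n + 1, x => ∃ e, src e = x ∧ HasWalk src tgt z n (tgt e)

/-- The directed distance from `x` to `z` is `n`. -/
def HasDist (src tgt : E → V) (z : V) (n : ℕ) (x : V) : Prop :=
  HasWalk src tgt z n x ∧ ∀ m < n, ¬ HasWalk src tgt z m x

lemma HasDist.unique {src tgt : E → V} {z x : V} {m n : ℕ}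
    (hm : HasDist src tgt z m x) (hn : HasDist src tgt z n x) : m = n := by
  rcases lt_trichotomy m n with h | h | h
  · exact absurd hm.1 (hn.2 m h)
  · exact h
  · exact absurd hn.1 (hm.2 n h)

lemma exists_hasDist_of_reflTransGen {src tgt : E → V} {z x : V}
    (h : ReflTransGen (linkRel src tgt Set.univ) x z) : ∃ n, HasDist src tgt z n x := by
  have hw : ∃ n, HasWalk src tgt z n x := by
    induction h using ReflTransGen.head_induction_on with
    | refl => exact ⟨0, rfl⟩
    | head hxy _ ih =>
      obtain ⟨f, -, hs, rfl⟩ := hxy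
      obtain ⟨n, hn⟩ := ih
      exact ⟨n + 1, f, hs, hn⟩
  exact ⟨Nat.find hw, Nat.find_spec hw, fun m hm => Nat.find_min hw hm⟩

lemma exists_geodesic {src tgt : E → V} (e : E) {n : ℕ} {x : V}
    (h : HasDist src tgt (src e) n x) :
    ∃ c : Fin (n + 1) → E, src (c 0) = x ∧ c (Fin.last n) = e ∧
      (∀ i : Fin n, tgt (c i.castSucc) = src (c i.succ)) ∧
      ∀ i : Fin (n + 1), HasDist src tgt (src e) (n - i) (src (c i)) := by
  induction n generalizing x with
  | zero =>
    refine ⟨fun _ => e, h.1.symm, rfl, fun i => i.elim0, fun i => ?_⟩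
    exact ⟨by simp [HasWalk], by simp⟩
  | succ n ih =>
    obtain ⟨f, hf, hw⟩ := h.1
    obtain ⟨c, h0, hl, hc, hd⟩ := ih (x := tgt f)
      ⟨hw, fun m hm hm' => h.2 (m + 1) (by omega) ⟨f, hf, hm'⟩⟩
    refine ⟨Fin.cons f c, by simpa using hf, ?_, ?_, ?_⟩
    · rw [← Fin.succ_last, Fin.cons_succ, hl]
    · intro i
      refine Fin.cases ?_ (fun j => ?_) i
      · simp [h0]
      · rw [← Fin.succ_castSucc, Fin.cons_succ, Fin.cons_succ, hc]
    · intro i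
      refine Fin.cases ?_ (fun j => ?_) i
      · simpa [hf] using h
      · simpa using hd j

lemma totallyCyclic_iff (src tgt : E → V) :
    TotallyCyclic src tgt ↔
      ∀ e, ReflTransGen (linkRel src tgt Set.univ) (tgt e) (src e) := by
  refine forall_congr' fun e => ⟨?_, fun h => ?_⟩
  · rintro ⟨n, c, ⟨-, hc⟩, i, rfl⟩
    have key : ∀ k : Fin (n + 1), ReflTransGen (linkRel src tgt Set.univ) (tgt (c i))
        (src (c (i + 1 + k))) := by
      intro k
      induction k using Fin.induction with
      | zero => simp [hc, ReflTransGen.refl]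
      | succ k ih =>
        refine ih.tail ⟨_, trivial, rfl, ?_⟩
        rw [hc, add_assoc, Fin.coeSucc_eq_succ]
    have h := key (Fin.last n)
    rwa [add_assoc, add_comm 1, Fin.last_add_one, add_zero] at h
  · obtain ⟨n, hn⟩ := exists_hasDist_of_reflTransGen h
    obtain ⟨c, h0, hl, hc, hd⟩ := exists_geodesic e hn
    refine ⟨n, c, ⟨fun i j hij => ?_, fun i => ?_⟩, Fin.last n, hl⟩
    · have hi := hd i
      simp only at hij
      rw [hij] at hi
      have := hi.unique (hd j)
      ext
      omega
    · refine Fin.lastCases ?_ (fun j => ?_) i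
      · rw [hl, Fin.last_add_one, h0]
      · rw [hc, Fin.coeSucc_eq_succ]

lemma linkRel_mono {src tgt : E → V} {S T : Set E} (h : S ⊆ T) {u v : V}
    (huv : linkRel src tgt S u v) : linkRel src tgt T u v :=
  huv.imp fun _ hf => ⟨h hf.1, hf.2⟩

lemma linkRel_rsrc_rtgt_or (src tgt : E → V) (σ S : Set E) {u v : V}
    (h : linkRel src tgt S u v) :
    linkRel (rsrc src tgt σ) (rtgt src tgt σ) S u v ∨
      linkRel (rsrc src tgt σ) (rtgt src tgt σ) S v u := by
  obtain ⟨f, hf, rfl, rfl⟩ := h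
  by_cases hσ : f ∈ σ
  · exact .inr ⟨f, hf, by simp [rsrc, hσ], by simp [rtgt, hσ]⟩
  · exact .inl ⟨f, hf, by simp [rsrc, hσ], by simp [rtgt, hσ]⟩

/-- A directed walk ending at the source of `e` need not use `e`. -/
lemma reflTransGen_compl_of_reflTransGen {src tgt : E → V} (e : E) {x : V}
    (h : ReflTransGen (linkRel src tgt Set.univ) x (src e)) :
    ReflTransGen (linkRel src tgt {e}ᶜ) x (src e) := by
  induction h using ReflTransGen.head_induction_on with
  | refl => exact .refl
  | head hxy _ ih =>
    obtain ⟨f, -, rfl, rfl⟩ := hxy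
    by_cases hf : f = e
    · subst hf
      exact .refl
    · exact ih.head ⟨f, hf, rfl, rfl⟩

lemma ncompSub_compl_eq_ncomp_add_one [Finite V] (src tgt : E → V) (e : E)
    (h : (Quot.mk (linkRel src tgt {e}ᶜ) (src e)) ≠ Quot.mk _ (tgt e)) :
    ncompSub src tgt ({e} : Set E)ᶜ = ncomp src tgt + 1 := by
  let b := Quot.mk (linkRel src tgt {e}ᶜ) (tgt e)
  let g : V → {x : Quot (linkRel src tgt {e}ᶜ) // x ≠ b} := fun v =>
    if hv : Quot.mk _ v = b then ⟨Quot.mk _ (src e), h⟩ else ⟨Quot.mk _ v, hv⟩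
  have hg : ∀ u v, linkRel src tgt Set.univ u v → g u = g v := by
    rintro _ _ ⟨f, -, rfl, rfl⟩
    by_cases hf : f = e
    · subst hf
      simp [g, b, h]
    · have := Quot.sound (r := linkRel src tgt {e}ᶜ) ⟨f, hf, rfl, rfl⟩
      simp [g, this]
  let r : Quot (linkRel src tgt {e}ᶜ) → Quot (linkRel src tgt Set.univ) :=
    Quot.map id fun _ _ => linkRel_mono (Set.subset_univ _)
  let φ : Quot (linkRel src tgt Set.univ) ≃ {x : Quot (linkRel src tgt {e}ᶜ) // x ≠ b} :=
    { toFun := Quot.lift g hg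
      invFun := fun x => r x.1
      left_inv := by
        rintro ⟨v⟩
        by_cases hv : Quot.mk (linkRel src tgt {e}ᶜ) v = b
        · have h1 : g v = ⟨Quot.mk _ (src e), h⟩ := dif_pos hv
          change r (g v).1 = _
          rw [h1]
          have h2 : Quot.mk (linkRel src tgt Set.univ) v = Quot.mk _ (tgt e) :=
            congrArg r hv
          exact (Quot.sound ⟨e, trivial, rfl, rfl⟩).trans h2.symm
        · have h1 : g v = ⟨Quot.mk _ v, hv⟩ := dif_neg hv
          change r (g v).1 = _
          rw [h1]
          rfl
      right_inv := by
        rintro ⟨⟨v⟩, hv⟩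
        exact dif_neg hv }
  rw [ncomp, ncompSub, ncompSub, Nat.card_congr φ, ← Finite.card_option]
  exact (Nat.card_congr (Equiv.optionSubtypeNe b)).symm

lemma tcReorDel_iff (src tgt : E → V) (e : E) (σ : Set E) :
    TCReorDel src tgt {e} (σ ∩ {e}ᶜ) ↔
      ∀ f, f ≠ e → ReflTransGen (linkRel (rsrc src tgt σ) (rtgt src tgt σ) {e}ᶜ)
        (rtgt src tgt σ f) (rsrc src tgt σ f) := by
  have hs : rsrc (dsrc src {e}) (dsrc tgt {e}) {f | f.1 ∈ σ ∩ {e}ᶜ} =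
      fun f => rsrc src tgt σ f.1 := by
    ext f
    simp [rsrc, dsrc]
  have ht : rtgt (dsrc src {e}) (dsrc tgt {e}) {f | f.1 ∈ σ ∩ {e}ᶜ} =
      fun f => rtgt src tgt σ f.1 := by
    ext f
    simp [rtgt, dsrc]
  have hr : linkRel (fun f : {f // f ∉ ({e} : Set E)} => rsrc src tgt σ f.1)
      (fun f => rtgt src tgt σ f.1) Set.univ =
      linkRel (rsrc src tgt σ) (rtgt src tgt σ) {e}ᶜ := by
    ext u v
    constructor
    · rintro ⟨f, -, h⟩
      exact ⟨f.1, f.2, h⟩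
    · rintro ⟨f, hf, h⟩
      exact ⟨⟨f, hf⟩, trivial, h⟩
  rw [TCReorDel, hs, ht, totallyCyclic_iff, hr]
  exact ⟨fun h f hf => h ⟨f, hf⟩, fun h f => h f.1 f.2⟩

lemma tcReorContr_of_totallyCyclic (src tgt : E → V) (e : E) (σ : Set E)
    (hσ : TotallyCyclic (rsrc src tgt σ) (rtgt src tgt σ)) :
    TCReorContr src tgt {e} (σ ∩ {e}ᶜ) := by
  have hs : rsrc (csrc src tgt {e}) (ctgt src tgt {e}) {f | f.1 ∈ σ ∩ {e}ᶜ} =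
      fun f => Quot.mk _ (rsrc src tgt σ f.1) := by
    ext f
    by_cases h : f.1 ∈ σ <;> simp [rsrc, csrc, ctgt, h]
  have ht : rtgt (csrc src tgt {e}) (ctgt src tgt {e}) {f | f.1 ∈ σ ∩ {e}ᶜ} =
      fun f => Quot.mk _ (rtgt src tgt σ f.1) := by
    ext f
    by_cases h : f.1 ∈ σ <;> simp [rtgt, csrc, ctgt, h]
  rw [TCReorContr, hs, ht, totallyCyclic_iff]
  intro f
  refine ReflTransGen.lift' (Quot.mk _) ?_ _ _ ((totallyCyclic_iff _ _).1 hσ f.1)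
  rintro _ _ ⟨g, -, rfl, rfl⟩
  by_cases hg : g = e
  · subst hg
    have he : Quot.mk (linkRel src tgt {g}) (src g) = Quot.mk _ (tgt g) :=
      Quot.sound ⟨g, rfl, rfl, rfl⟩
    have : Quot.mk (linkRel src tgt {g}) (rsrc src tgt σ g) =
        Quot.mk _ (rtgt src tgt σ g) := by
      by_cases h : g ∈ σ <;> simp [rsrc, rtgt, h, he]
    change ReflTransGen _ (Quot.mk _ _) (Quot.mk _ _)
    rw [this]
  · exact .single ⟨⟨g, hg⟩, trivial, rfl, rfl⟩

lemma reflTransGen_of_quot_eq {src tgt : E → V} {S σ : Set E}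
    (hS : ∀ f ∈ S, ReflTransGen (linkRel (rsrc src tgt σ) (rtgt src tgt σ) S)
      (rtgt src tgt σ f) (rsrc src tgt σ f)) {u v : V}
    (h : Quot.mk (linkRel src tgt S) u = Quot.mk _ v) :
    ReflTransGen (linkRel (rsrc src tgt σ) (rtgt src tgt σ) S) u v := by
  have hsymm : ∀ {u v}, ReflTransGen (linkRel (rsrc src tgt σ) (rtgt src tgt σ) S) u v →
      ReflTransGen (linkRel (rsrc src tgt σ) (rtgt src tgt σ) S) v u := by
    intro u v huv
    induction huv with
    | refl => exact .refl
    | tail _ hbc ih =>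
      obtain ⟨f, hf, rfl, rfl⟩ := hbc
      exact (hS f hf).trans ih
  induction Quot.eqvGen_exact h with
  | rel x y hxy =>
    rcases linkRel_rsrc_rtgt_or src tgt σ S hxy with h | h
    · exact .single h
    · exact hsymm (.single h)
  | refl => exact .refl
  | symm x y hxy ih => exact hsymm (ih (Quot.eqvGen_sound hxy))
  | trans x y z hxy hyz ih₁ ih₂ =>
    exact (ih₁ (Quot.eqvGen_sound hxy)).trans (ih₂ (Quot.eqvGen_sound hyz))

lemma rsrc_symmDiff_of_ne (src tgt : E → V) (σ : Set E) {e f : E} (h : f ≠ e) :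
    rsrc src tgt (symmDiff σ {e}) f = rsrc src tgt σ f := by
  simp [rsrc, Set.mem_symmDiff, h]

lemma rtgt_symmDiff_of_ne (src tgt : E → V) (σ : Set E) {e f : E} (h : f ≠ e) :
    rtgt src tgt (symmDiff σ {e}) f = rtgt src tgt σ f := by
  simp [rtgt, Set.mem_symmDiff, h]

lemma rsrc_symmDiff_self (src tgt : E → V) (σ : Set E) (e : E) :
    rsrc src tgt (symmDiff σ {e}) e = rtgt src tgt σ e := by
  by_cases h : e ∈ σ <;> simp [rsrc, rtgt, Set.mem_symmDiff, h]

lemma rtgt_symmDiff_self (src tgt : E → V) (σ : Set E) (e : E) :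
    rtgt src tgt (symmDiff σ {e}) e = rsrc src tgt σ e := by
  by_cases h : e ∈ σ <;> simp [rsrc, rtgt, Set.mem_symmDiff, h]

lemma linkRel_symmDiff_compl (src tgt : E → V) (σ : Set E) (e : E) :
    linkRel (rsrc src tgt (symmDiff σ {e})) (rtgt src tgt (symmDiff σ {e})) {e}ᶜ =
      linkRel (rsrc src tgt σ) (rtgt src tgt σ) {e}ᶜ := by
  ext u v
  refine exists_congr fun f => and_congr_right fun hf => ?_
  rw [rsrc_symmDiff_of_ne _ _ _ hf, rtgt_symmDiff_of_ne _ _ _ hf]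

/-- For `e` neither a loop nor a coloop and a totally cyclic reorientation `σ`
of `G`: (1) `σ ∩ (E ∖ {e})` is a totally cyclic reorientation of `G/e`;
(2) `σ ∩ (E ∖ {e})` is a totally cyclic reorientation of `G∖e` iff both `σ`
and `σ Δ {e}` are totally cyclic reorientations of `G`. -/
theorem tco_projection {V E : Type} [Fintype V] [Fintype E]
    (src tgt : E → V) (e : E)
    (hloop : src e ≠ tgt e) (hcoloop : ¬ IsColoop src tgt e)
    (σ : Set E) (hσ : TotallyCyclic (rsrc src tgt σ) (rtgt src tgt σ)) :
    TCReorContr src tgt ({e} : Set E) (σ ∩ ({e} : Set E)ᶜ) ∧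
    (TCReorDel src tgt ({e} : Set E) (σ ∩ ({e} : Set E)ᶜ) ↔
      (TotallyCyclic (rsrc src tgt σ) (rtgt src tgt σ) ∧
       TotallyCyclic (rsrc src tgt (symmDiff σ {e}))
                     (rtgt src tgt (symmDiff σ {e})))) := by
  refine ⟨tcReorContr_of_totallyCyclic src tgt e σ hσ, ?_⟩
  rw [tcReorDel_iff]
  constructor
  · refine fun h => ⟨hσ, (totallyCyclic_iff _ _).2 fun f => ?_⟩
    refine ReflTransGen.mono (fun _ _ => linkRel_mono (Set.subset_univ {e}ᶜ)) _ _ ?_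
    rw [linkRel_symmDiff_compl]
    by_cases hf : f = e
    · subst hf
      rw [rsrc_symmDiff_self, rtgt_symmDiff_self]
      have hq : Quot.mk (linkRel src tgt {f}ᶜ) (src f) = Quot.mk _ (tgt f) := by
        by_contra hne
        exact hcoloop (ncompSub_compl_eq_ncomp_add_one src tgt f hne)
      refine reflTransGen_of_quot_eq (S := {f}ᶜ) h ?_
      by_cases hfσ : f ∈ σ <;> simp [rsrc, rtgt, hfσ, hq]
    · rw [rsrc_symmDiff_of_ne _ _ _ hf, rtgt_symmDiff_of_ne _ _ _ hf]
      exact h f hf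
  · rintro ⟨-, hσ'⟩ f -
    have he := reflTransGen_compl_of_reflTransGen e ((totallyCyclic_iff _ _).1 hσ' e)
    rw [linkRel_symmDiff_compl, rsrc_symmDiff_self, rtgt_symmDiff_self] at he
    refine reflTransGen_closed ?_ _ _ ((totallyCyclic_iff _ _).1 hσ f)
    rintro _ _ ⟨g, -, rfl, rfl⟩
    by_cases hg : g = e
    · rwa [hg]
    · exact .single ⟨g, hg, rfl, rfl⟩

end ModularFlows
end
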